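/- Let a, b, N be real numbers with a, a+b+1, a+b+N+1 ∉ {−1,−2,−3,…}. For all integers x ≥ 0 and n ≥ 0, the following duality between Hahn and dual Hahn polynomials holds: (a+b+1)_n (−N)_n · R_x^{a,b,N}(n(n+a+b+1)) = (−1)^n n! (N+a+b+2)_n (−N)_x · h_n^{a,b,N}(x). -/

import Mathlib

open Polynomial Finset

/-- Pochhammer symbol `(z)_k = z(z+1)⋯(z+k−1)` for real `z`. -/
noncomputable def pch (k : ℕ) (z : ℝ) : ℝ := (ascPochhammer ℝ k).eval z

/-- The Hahn polynomial. -/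
noncomputable def hahn (a b N : ℝ) (n : ℕ) : Polynomial ℝ :=
  ∑ j ∈ Finset.range (n + 1),
    Polynomial.C (pch (n - j) (N - (n : ℝ) + 1) * pch (j + n) (a + b + 1) /
      (pch n (2 + a + b + N) * pch j (a + 1) *
        (Nat.factorial (n - j) : ℝ) * (Nat.factorial j : ℝ))) *
      ((ascPochhammer ℝ j).comp (-Polynomial.X))

/-- The dual Hahn polynomial
`R_n^{a,b,N}(x) = Σ_{j=0}^n [(−1)^j (−n)_j (−N+j)_{n−j} / ((a+1)_j j!)]
  ∏_{i=0}^{j−1}[x − i(i+a+b+1)]`. -/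
noncomputable def dualHahn (a b N : ℝ) (n : ℕ) (x : ℝ) : ℝ :=
  ∑ j ∈ Finset.range (n + 1),
    ((-1 : ℝ) ^ j * pch j (-(n : ℝ)) * pch (n - j) (-N + (j : ℝ)) /
      (pch j (a + 1) * (Nat.factorial j : ℝ))) *
      ∏ i ∈ Finset.range j, (x - (i : ℝ) * ((i : ℝ) + a + b + 1))

theorem pch_eq_prod (k : ℕ) (z : ℝ) : pch k z = ∏ i ∈ Finset.range k, (z + (i : ℝ)) := by
  induction k with
  | zero => simp [pch]
  | succ k ih => rw [Finset.prod_range_succ, ← ih, pch, ascPochhammer_succ_eval, pch]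

theorem pch_add (m k : ℕ) (z : ℝ) : pch (m + k) z = pch m z * pch k (z + (m : ℝ)) := by
  simp only [pch_eq_prod, Finset.prod_range_add, Nat.cast_add, add_assoc]

theorem pch_reflect (k : ℕ) (z : ℝ) : pch k z = (-1 : ℝ) ^ k * pch k (1 - z - (k : ℝ)) := by
  rw [pch_eq_prod, pch_eq_prod, ← Finset.prod_range_reflect]
  conv_rhs => rw [← Finset.card_range k, ← Finset.prod_const, Finset.card_range,
    ← Finset.prod_mul_distrib]
  refine Finset.prod_congr rfl fun i hi => ?_
  have hik : i + 1 ≤ k := Finset.mem_range.mp hi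
  rw [Nat.sub_sub, Nat.cast_sub (by omega)]
  push_cast
  ring

theorem pch_neg_natCast_eq_zero {n j : ℕ} (h : n < j) : pch j (-(n : ℝ)) = 0 := by
  rw [pch_eq_prod]
  exact Finset.prod_eq_zero (Finset.mem_range.mpr h) (by ring)

theorem factorial_mul_pch (m j : ℕ) :
    (Nat.factorial m : ℝ) * pch j ((m : ℝ) + 1) = (Nat.factorial (m + j) : ℝ) := by
  rw [pch_eq_prod]
  induction j with
  | zero => simp
  | succ j ih =>
    rw [Finset.prod_range_succ, ← mul_assoc, ih, ← add_assoc, Nat.factorial_succ]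
    push_cast
    ring

theorem factorial_mul_pch_neg {n j : ℕ} (h : j ≤ n) :
    (Nat.factorial (n - j) : ℝ) * pch j (-(n : ℝ)) = (-1 : ℝ) ^ j * (Nat.factorial n : ℝ) := by
  obtain ⟨m, rfl⟩ := Nat.exists_eq_add_of_le' h
  rw [pch_reflect, Nat.add_sub_cancel, ← factorial_mul_pch m j]
  have : 1 - -((m + j : ℕ) : ℝ) - (j : ℝ) = (m : ℝ) + 1 := by push_cast; ring
  rw [this]
  ring

theorem pch_mul_pch_sub {m j : ℕ} (h : j ≤ m) (z : ℝ) :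
    pch j z * pch (m - j) (z + (j : ℝ)) = pch m z := by
  rw [← pch_add, Nat.add_sub_cancel' h]

theorem pch_ne_zero {z : ℝ} (h : ∀ k : ℕ, z ≠ -(k : ℝ)) (n : ℕ) : pch n z ≠ 0 := by
  rw [pch_eq_prod]
  exact Finset.prod_ne_zero_iff.mpr fun k _ hk => h k (eq_neg_of_add_eq_zero_left hk)

/-- The eigenvalue lattice `n(n+s)` factors the product in the dual Hahn polynomial. -/
theorem prod_lattice_eq (n j : ℕ) (a b : ℝ) :
    ∏ i ∈ Finset.range j,
        ((n : ℝ) * ((n : ℝ) + a + b + 1) - (i : ℝ) * ((i : ℝ) + a + b + 1))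
      = (-1 : ℝ) ^ j * pch j (-(n : ℝ)) * pch j (a + b + 1 + (n : ℝ)) := by
  rw [pch_eq_prod, pch_eq_prod]
  induction j with
  | zero => simp
  | succ j ih =>
    rw [Finset.prod_range_succ, ih, Finset.prod_range_succ, Finset.prod_range_succ]
    ring

/-- The summand common to both sides of the duality. -/
noncomputable def dualityTerm (a b N : ℝ) (x n j : ℕ) : ℝ :=
  pch j (-(x : ℝ)) * pch j (-(n : ℝ)) * pch j (-N) * pch (n - j) (-N + (j : ℝ)) *
    pch (x - j) (-N + (j : ℝ)) * pch (n + j) (a + b + 1) / (pch j (a + 1) * (Nat.factorial j : ℝ))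

theorem dualityTerm_eq_zero_of_lt_left (a b N : ℝ) {x n j : ℕ} (h : x < j) :
    dualityTerm a b N x n j = 0 := by
  simp [dualityTerm, pch_neg_natCast_eq_zero h]

theorem dualityTerm_eq_zero_of_lt_right (a b N : ℝ) {x n j : ℕ} (h : n < j) :
    dualityTerm a b N x n j = 0 := by
  simp [dualityTerm, pch_neg_natCast_eq_zero h]

theorem sum_dualityTerm_eq (a b N : ℝ) (x n : ℕ) :
    ∑ j ∈ Finset.range (x + 1), dualityTerm a b N x n j
      = ∑ j ∈ Finset.range (n + 1), dualityTerm a b N x n j := by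
  trans ∑ j ∈ Finset.range (x + n + 1), dualityTerm a b N x n j
  · refine Finset.sum_subset (Finset.range_subset_range.mpr (by omega)) fun j _ hj => ?_
    exact dualityTerm_eq_zero_of_lt_left a b N (by rw [Finset.mem_range] at hj; omega)
  · refine (Finset.sum_subset (Finset.range_subset_range.mpr (by omega)) fun j _ hj => ?_).symm
    exact dualityTerm_eq_zero_of_lt_right a b N (by rw [Finset.mem_range] at hj; omega)

theorem dualHahn_eq_sum_dualityTerm (a b N : ℝ) (x n : ℕ) :
    pch n (a + b + 1) * pch n (-N) * dualHahn a b N x ((n : ℝ) * ((n : ℝ) + a + b + 1))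
      = ∑ j ∈ Finset.range (x + 1), dualityTerm a b N x n j := by
  rw [dualHahn, Finset.mul_sum]
  refine Finset.sum_congr rfl fun j _ => ?_
  rw [prod_lattice_eq]
  rcases lt_or_ge n j with hnj | hjn
  · rw [dualityTerm_eq_zero_of_lt_right a b N hnj, pch_neg_natCast_eq_zero hnj]
    ring
  · have hsq : (-1 : ℝ) ^ j * (-1 : ℝ) ^ j = 1 := by rw [← mul_pow]; simp
    rw [dualityTerm, pch_add n j, ← pch_mul_pch_sub hjn (-N)]
    linear_combination (pch n (a + b + 1) * (pch j (-N) * pch (n - j) (-N + (j : ℝ))) *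
      pch j (-(x : ℝ)) * pch (x - j) (-N + (j : ℝ)) / (pch j (a + 1) * (Nat.factorial j : ℝ)) *
      pch j (-(n : ℝ)) * pch j (a + b + 1 + (n : ℝ))) * hsq

theorem hahn_eval_eq_sum_dualityTerm (a b N : ℝ)
    (habN1 : ∀ k : ℕ, a + b + N + 1 ≠ -((k : ℝ) + 1)) (x n : ℕ) :
    (-1 : ℝ) ^ n * (Nat.factorial n : ℝ) * pch n (N + a + b + 2) * pch x (-N) *
          (hahn a b N n).eval (x : ℝ)
      = ∑ j ∈ Finset.range (n + 1), dualityTerm a b N x n j := by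
  have hne : pch n (2 + a + b + N) ≠ 0 :=
    pch_ne_zero (fun k hk => habN1 k (by linear_combination hk)) n
  have hcomm : N + a + b + 2 = 2 + a + b + N := by ring
  rw [hahn, Polynomial.eval_finsetSum, Finset.mul_sum, hcomm]
  refine Finset.sum_congr rfl fun j hj => ?_
  have hjn : j ≤ n := Nat.lt_succ_iff.mp (Finset.mem_range.mp hj)
  simp only [Polynomial.eval_mul, Polynomial.eval_C, Polynomial.eval_comp, Polynomial.eval_neg,
    Polynomial.eval_X]
  change _ * (_ * pch j (-(x : ℝ))) = _
  rcases lt_or_ge x j with hxj | hjx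
  · rw [dualityTerm_eq_zero_of_lt_left a b N hxj, pch_neg_natCast_eq_zero hxj]
    ring
  · have hfac : (Nat.factorial (n - j) : ℝ) ≠ 0 := by exact_mod_cast Nat.factorial_ne_zero _
    have hsq : (-1 : ℝ) ^ j * (-1 : ℝ) ^ j = 1 := by rw [← mul_pow]; simp
    have hfall : (Nat.factorial n : ℝ)
        = (-1 : ℝ) ^ j * ((Nat.factorial (n - j) : ℝ) * pch j (-(n : ℝ))) := by
      rw [factorial_mul_pch_neg hjn, ← mul_assoc, hsq, one_mul]
    have hsign : (-1 : ℝ) ^ n = (-1 : ℝ) ^ (n - j) * (-1 : ℝ) ^ j := by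
      rw [← pow_add, Nat.sub_add_cancel hjn]
    have hrefl : pch (n - j) (-N + (j : ℝ))
        = (-1 : ℝ) ^ (n - j) * pch (n - j) (N - (n : ℝ) + 1) := by
      rw [pch_reflect, Nat.cast_sub hjn]
      congr 2
      ring
    have hcancel : (-1 : ℝ) ^ n * (Nat.factorial n : ℝ) / (Nat.factorial (n - j) : ℝ)
        = (-1 : ℝ) ^ (n - j) * pch j (-(n : ℝ)) := by
      rw [hfall, hsign, div_eq_iff hfac]
      linear_combination ((-1 : ℝ) ^ (n - j) * pch j (-(n : ℝ)) *
        (Nat.factorial (n - j) : ℝ)) * hsq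
    calc _ = (-1 : ℝ) ^ n * (Nat.factorial n : ℝ) / (Nat.factorial (n - j) : ℝ) *
          (pch n (2 + a + b + N) / pch n (2 + a + b + N)) * pch x (-N) *
          pch (n - j) (N - (n : ℝ) + 1) * pch (j + n) (a + b + 1) * pch j (-(x : ℝ)) /
          (pch j (a + 1) * (Nat.factorial j : ℝ)) := by
          simp only [div_eq_mul_inv, mul_inv]
          ring
      _ = _ := by
          rw [hcancel, div_self hne, dualityTerm, hrefl, ← pch_mul_pch_sub hjx (-N),
            Nat.add_comm j n]
          ring

/-- Duality between Hahn and dual Hahn polynomials. -/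
theorem hahn_dualHahn_duality (a b N : ℝ)
    (ha : ∀ k : ℕ, a ≠ -((k : ℝ) + 1))
    (hab1 : ∀ k : ℕ, a + b + 1 ≠ -((k : ℝ) + 1))
    (habN1 : ∀ k : ℕ, a + b + N + 1 ≠ -((k : ℝ) + 1))
    (x n : ℕ) :
    pch n (a + b + 1) * pch n (-N) * dualHahn a b N x ((n : ℝ) * ((n : ℝ) + a + b + 1))
      = (-1 : ℝ) ^ n * (Nat.factorial n : ℝ) * pch n (N + a + b + 2) * pch x (-N) *
          (hahn a b N n).eval (x : ℝ) := by
  rw [dualHahn_eq_sum_dualityTerm, hahn_eval_eq_sum_dualityTerm a b N habN1, sum_dualityTerm_eq]
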